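/- Let (X, μ, T) be a dynamical system with r_top(ρ_μ) = (log λ)·ℤ for some 0 < λ < 1 (it is not assumed that r(ρ_μ) = (log λ)·ℤ). Then there exists a probability measure μ̃ equivalent to μ such that ρ_{μ̃}(x,y) ∈ (log λ)·ℤ for all (x,y) ∈ R_T and the Radon–Nikodym derivative dμ̃/dμ is continuous when restricted to some inessential reduction of X. -/

import Mathlib

open MeasureTheory Topology

/-- `X` is 0-dimensional: it has a countable base of clopen sets. -/
def ZeroDimensional (X : Type*) [TopologicalSpace X] : Prop :=
  ∃ b : Set (Set X), b.Countable ∧ (∀ s ∈ b, IsClopen s) ∧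
    TopologicalSpace.IsTopologicalBasis b

/-- A dynamical system: a non-atomic Borel probability measure of full support on a
topological space together with an ergodic non-singular homeomorphism whose
Radon–Nikodym derivative `d(μ∘T)/dμ` has the continuous version `ω`. -/
structure DynSys (X : Type*) [TopologicalSpace X] [MeasurableSpace X] where
  μ : Measure X
  T : X ≃ₜ X
  ω : X → ℝ
  prob : IsProbabilityMeasure μ
  noAtoms : NoAtoms μ
  fullSupport : ∀ U : Set X, IsOpen U → U.Nonempty → 0 < μ U
  ergodic : ∀ A : Set X, MeasurableSet A → (⇑T) ⁻¹' A = A → μ A = 0 ∨ μ A = 1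
  ωCont : Continuous ω
  ωPos : ∀ x, 0 < ω x
  rnDeriv : Measure.map (⇑T.symm) μ = μ.withDensity (fun x => ENNReal.ofReal (ω x))

namespace DynSys

variable {X Y : Type*} [TopologicalSpace X] [MeasurableSpace X]
  [TopologicalSpace Y] [MeasurableSpace Y]

/-- The iterate `Tⁿ` for `n : ℤ`. -/
noncomputable def iter (D : DynSys X) (n : ℤ) (x : X) : X :=
  (D.T.toEquiv ^ n) x

/-- The Radon–Nikodym cocycle `ρ_μ(x, Tⁿx)`. -/
noncomputable def rho (D : DynSys X) (x : X) (n : ℤ) : ℝ :=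
  if 0 ≤ n then ∑ i ∈ Finset.range n.toNat, Real.log (D.ω (D.iter (i : ℤ) x))
  else - ∑ i ∈ Finset.range (-n).toNat, Real.log (D.ω (D.iter (i : ℤ) (D.iter n x)))

/-- An inessential reduction: a `T`-invariant dense `G_δ` subset of full measure. -/
def InessRed (D : DynSys X) (X' : Set X) : Prop :=
  (⇑D.T) ⁻¹' X' = X' ∧ Dense X' ∧ IsGδ X' ∧ D.μ X' = 1

/-- A set is virtually clopen if its intersection with some inessential reduction `X'`
is relatively clopen in `X'`. -/
def VirtClopen (D : DynSys X) (A : Set X) : Prop :=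
  ∃ X' : Set X, D.InessRed X' ∧ IsClopen (Subtype.val ⁻¹' A : Set X')

/-- The asymptotic range `r(ρ_μ)` of the Radon–Nikodym cocycle. -/
def asymRange (D : DynSys X) : Set ℝ :=
  {t | ∀ ε : ℝ, 0 < ε → ∀ A : Set X, MeasurableSet A → 0 < D.μ A →
    ∃ k : ℤ, k ≠ 0 ∧ ∃ B : Set X, MeasurableSet B ∧ B ⊆ A ∧ 0 < D.μ B ∧
      ∀ x ∈ B, |D.rho x k - t| < ε}

/-- The topological asymptotic range `r_top(ρ_μ)` of the Radon–Nikodym cocycle. -/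
def topAsymRange (D : DynSys X) : Set ℝ :=
  {t | ∀ ε : ℝ, 0 < ε → ∀ A : Set X, D.VirtClopen A → 0 < D.μ A →
    ∃ k : ℤ, k ≠ 0 ∧ ∃ B : Set X, B ⊆ A ∧ 0 < D.μ B ∧
      ∀ x ∈ B, |D.rho x k - t| < ε}

/-- Type `III`: there is no equivalent σ-finite `T`-invariant measure. -/
def TypeIII (D : DynSys X) : Prop :=
  ¬ ∃ ν : Measure X, SigmaFinite ν ∧ ν ≪ D.μ ∧ D.μ ≪ ν ∧ Measure.map (⇑D.T) ν = ν

/-- Almost continuous orbit equivalence of two dynamical systems. -/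
def ACOE (D : DynSys X) (E : DynSys Y) : Prop :=
  ∃ (X₀ : Set X) (Y₀ : Set Y) (φ : X → Y) (ψ : Y → X),
    D.InessRed X₀ ∧ E.InessRed Y₀ ∧
    Set.BijOn φ X₀ Y₀ ∧ ContinuousOn φ X₀ ∧ ContinuousOn ψ Y₀ ∧ Set.InvOn ψ φ X₀ Y₀ ∧
    (∀ x ∈ X₀, φ '' {z | ∃ k : ℤ, z = D.iter k x} = {w | ∃ k : ℤ, w = E.iter k (φ x)}) ∧
    (∃ f : Y → ℝ, ContinuousOn f Y₀ ∧ (∀ y ∈ Y₀, 0 < f y) ∧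
      ∀ A : Set Y, MeasurableSet A →
        D.μ (φ ⁻¹' A ∩ X₀) = ∫⁻ y in A, ENNReal.ofReal (f y) ∂E.μ) ∧
    (∃ n m : X → ℤ, ContinuousOn n X₀ ∧ ContinuousOn m X₀ ∧
      ∀ x ∈ X₀, φ (D.T x) = E.iter (n x) (φ x) ∧ E.T (φ x) = φ (D.iter (m x) x))

end DynSys

/-- An `r`-uniform subrelation of `R_T` on the clopen set `C`, with fundamental
(clopen) subset `B` and splitting homeomorphism `(i, b) ↦ h i b : I_r × B → C`,
each `h i` being given on `B` by `h i b = T^(a i b) b` with `a i` continuous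
(i.e. `h i` belongs to the topological full groupoid `[[T]]_top`);
`proj` and `idx` form the continuous inverse, `proj` being the associated projection. -/
structure UniformRel {X : Type*} [TopologicalSpace X] [MeasurableSpace X]
    (D : DynSys X) (r : ℕ) (C B : Set X) where
  rpos : 0 < r
  h : Fin r → X → X
  a : Fin r → X → ℤ
  clopenB : IsClopen B
  subB : B ⊆ C
  h_zero : ∀ b ∈ B, h ⟨0, rpos⟩ b = b
  h_eq : ∀ (i : Fin r), ∀ b ∈ B, h i b = D.iter (a i b) b
  a_cont : ∀ i : Fin r, ContinuousOn (a i) B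
  h_cont : ∀ i : Fin r, ContinuousOn (h i) B
  maps : ∀ i : Fin r, Set.MapsTo (h i) B C
  inj : ∀ (i j : Fin r), ∀ b ∈ B, ∀ b' ∈ B, h i b = h j b' → i = j ∧ b = b'
  proj : X → X
  idx : X → Fin r
  proj_cont : ContinuousOn proj C
  idx_cont : ContinuousOn idx C
  proj_mem : ∀ x ∈ C, proj x ∈ B
  h_proj : ∀ x ∈ C, h (idx x) (proj x) = x

namespace DynSys

open Filter Set

section Iterates

variable {X : Type*} [TopologicalSpace X] [MeasurableSpace X] (D : DynSys X)

@[simp]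
lemma iter_zero (x : X) : D.iter 0 x = x := by simp [iter]

lemma iter_one (x : X) : D.iter 1 x = D.T x := by simp [iter]

lemma iter_iter (m n : ℤ) (x : X) : D.iter m (D.iter n x) = D.iter (m + n) x := by
  simp [iter, zpow_add]

lemma continuous_iter (n : ℤ) : Continuous (D.iter n) := by
  induction n using Int.induction_on with
  | zero =>
    rw [funext D.iter_zero]
    exact continuous_id
  | succ n ih =>
    have : D.iter (n + 1) = fun x => D.T (D.iter n x) := by
      ext x
      rw [← iter_one, iter_iter, add_comm]
    rw [this]
    exact D.T.continuous.comp ih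
  | pred n ih =>
    have : D.iter (-n - 1) = fun x => D.T.symm (D.iter (-n) x) := by
      ext x
      rw [Homeomorph.eq_symm_apply, ← iter_one, iter_iter]
      congr 1
      ring
    rw [this]
    exact D.T.symm.continuous.comp ih

@[simp]
lemma rho_zero (x : X) : D.rho x 0 = 0 := by simp [rho]

lemma rho_add_one (x : X) (n : ℤ) :
    D.rho x (n + 1) = D.rho x n + Real.log (D.ω (D.iter n x)) := by
  obtain ⟨k, rfl | rfl⟩ := n.eq_nat_or_neg
  · have h : ((k : ℤ) + 1).toNat = k + 1 := by omega
    rw [rho, rho, if_pos (by omega), if_pos (by omega), h, Finset.sum_range_succ]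
    simp
  · cases k with
    | zero => simp [rho]
    | succ k =>
      have h1 : (-(-((k + 1 : ℕ) : ℤ))).toNat = k + 1 := by omega
      have h2 : (-((k + 1 : ℕ) : ℤ) + 1) = -(k : ℤ) := by omega
      have h3 : D.rho x (-(k : ℤ)) =
          -∑ i ∈ Finset.range k, Real.log (D.ω (D.iter (i : ℤ) (D.iter (-(k : ℤ)) x))) := by
        cases k with
        | zero => simp
        | succ k =>
          rw [rho, if_neg (by omega)]
          simp
      rw [h2, h3, rho, if_neg (by omega), h1, Finset.sum_range_succ']
      simp only [iter_iter]
      simp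

lemma rho_add (x : X) (n m : ℤ) : D.rho x (n + m) = D.rho x n + D.rho (D.iter n x) m := by
  induction m using Int.induction_on with
  | zero => simp
  | succ m ih =>
    rw [← add_assoc, rho_add_one, ih, rho_add_one, iter_iter, add_comm (m : ℤ) n]
    ring
  | pred m ih =>
    have h1 := D.rho_add_one x (n + (-m - 1))
    have h2 := D.rho_add_one (D.iter n x) (-m - 1)
    rw [show n + (-(m : ℤ) - 1) + 1 = n + -m by ring, ih] at h1
    rw [sub_add_cancel, iter_iter, add_comm _ n] at h2
    linarith

lemma continuous_rho (n : ℤ) : Continuous fun x => D.rho x n := by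
  have hlog : ∀ k : ℤ, Continuous fun x => Real.log (D.ω (D.iter k x)) := fun k =>
    (D.ωCont.comp (D.continuous_iter k)).log fun x => (D.ωPos _).ne'
  induction n using Int.induction_on with
  | zero => simpa using continuous_const
  | succ n ih =>
    simp only [rho_add_one]
    exact ih.add (hlog _)
  | pred n ih =>
    have h : (fun x => D.rho x (-n - 1)) =
        fun x => D.rho x (-n) - Real.log (D.ω (D.iter (-n - 1) x)) := by
      ext x
      have := D.rho_add_one x (-n - 1)
      rw [sub_add_cancel] at this
      linarith
    rw [h]
    exact ih.sub (hlog _)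

lemma map_symm_absolutelyContinuous : Measure.map D.T.symm D.μ ≪ D.μ := by
  rw [D.rnDeriv]
  exact withDensity_absolutelyContinuous _ _

lemma dense_of_measure_compl_eq_zero {S : Set X} (hS : D.μ Sᶜ = 0) : Dense S := by
  rw [dense_iff_inter_open]
  intro U hU hne
  by_contra h
  have : U ⊆ Sᶜ := fun x hx hxS => h ⟨x, hx, hxS⟩
  exact (D.fullSupport U hU hne).ne' (measure_mono_null this hS)

end Iterates

section GraphClosure

variable {X : Type*} [TopologicalSpace X] [MeasurableSpace X] (D : DynSys X) {θ : ℝ}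

/-- The closure of the graphs of the functions `ρ_μ(·, Tⁿ ·)` modulo `θ`. -/
def graphClosure (θ : ℝ) : Set (X × AddCircle θ) :=
  closure {p | ∃ n : ℤ, p.2 = (D.rho p.1 n : AddCircle θ)}

lemma zero_mem_graphClosure (x : X) : (x, (0 : AddCircle θ)) ∈ D.graphClosure θ :=
  subset_closure ⟨0, by simp⟩

lemma iter_mem_graphClosure {x : X} {s : AddCircle θ} (h : (x, s) ∈ D.graphClosure θ) (n : ℤ) :
    (D.iter n x, s - (D.rho x n : AddCircle θ)) ∈ D.graphClosure θ := by
  have hc : Continuous fun p : X × AddCircle θ =>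
      (D.iter n p.1, p.2 - (D.rho p.1 n : AddCircle θ)) :=
    ((D.continuous_iter n).comp continuous_fst).prodMk <| continuous_snd.sub <|
      (AddCircle.continuous_mk' θ).comp ((D.continuous_rho n).comp continuous_fst)
  refine map_mem_closure (x := (x, s)) (f := fun p : X × AddCircle θ =>
      (D.iter n p.1, p.2 - (D.rho p.1 n : AddCircle θ))) hc h ?_
  rintro ⟨y, s⟩ ⟨m, hm⟩
  simp only at hm
  refine ⟨m - n, ?_⟩
  have := D.rho_add y n (m - n)
  rw [add_sub_cancel] at this
  simp only [hm, ← AddCircle.coe_sub, this, add_sub_cancel_left]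

lemma isClosed_section (x : X) : IsClosed {s : AddCircle θ | (x, s) ∈ D.graphClosure θ} :=
  isClosed_closure.preimage (Continuous.prodMk_right x)

/-- The sections of `graphClosure` are limits of translated sections along dense orbits. -/
lemma exists_translate_section [Fact (0 < θ)] {x : X}
    (hx : DenseRange fun n => D.iter n x) (y : X) :
    ∃ c : AddCircle θ, ∀ s, (x, s) ∈ D.graphClosure θ → (y, s - c) ∈ D.graphClosure θ := by
  have hcl : MapClusterPt y ⊤ fun n => D.iter n x := by
    rw [mapClusterPt_iff_frequently]
    intro U hU
    obtain ⟨_, hz, n, rfl⟩ := mem_closure_iff_nhds.1 (hx y) U hU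
    simpa using ⟨n, hz⟩
  obtain ⟨u, -, hu⟩ := mapClusterPt_iff_ultrafilter.1 hcl
  have hc := (u.map fun n => (D.rho x n : AddCircle θ)).le_nhds_lim
  refine ⟨(u.map fun n => (D.rho x n : AddCircle θ)).lim, fun s hs => ?_⟩
  exact isClosed_closure.mem_of_tendsto (hu.prodMk_nhds (tendsto_const_nhds.sub hc))
    (Eventually.of_forall fun n => D.iter_mem_graphClosure hs n)

lemma _root_.IsClosed.add_mem_of_forall_sub_mem {C : Type*} [AddCommGroup C] [TopologicalSpace C]
    [CompactSpace C] [IsTopologicalAddGroup C] {K : Set C} (hK : IsClosed K) {c : C}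
    (h : ∀ s ∈ K, s - c ∈ K) {s : C} (hs : s ∈ K) : s + c ∈ K := by
  obtain ⟨u, -, hu⟩ := mapClusterPt_iff_ultrafilter.1 (mapClusterPt_self_zsmul_atTop_nsmul c (-1))
  have hmem : ∀ n : ℕ, s - n • c ∈ K := by
    intro n
    induction n with
    | zero => simpa
    | succ n ih => simpa [succ_nsmul, sub_sub] using h _ ih
  simpa using hK.mem_of_tendsto (tendsto_const_nhds.sub hu) (Eventually.of_forall hmem)

lemma add_mem_graphClosure [Fact (0 < θ)] {x y : X} (hy : DenseRange fun n => D.iter n y)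
    {c : AddCircle θ} (hc : ∀ s, (x, s) ∈ D.graphClosure θ → (y, s - c) ∈ D.graphClosure θ)
    {s : AddCircle θ} (hs : (y, s) ∈ D.graphClosure θ) : (x, s + c) ∈ D.graphClosure θ := by
  obtain ⟨d, hd⟩ := D.exists_translate_section (θ := θ) hy x
  have h := (D.isClosed_section (θ := θ) x).add_mem_of_forall_sub_mem (c := c + d)
    (fun s hs => by simpa [sub_sub] using hd _ (hc s hs)) (hd s hs)
  simpa [sub_add_add_cancel, add_comm c d, ← add_assoc] using h

end GraphClosure

section Reductions

variable {X : Type*} [TopologicalSpace X] [MeasurableSpace X] [BorelSpace X] (D : DynSys X)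

lemma absolutelyContinuous_map_symm : D.μ ≪ Measure.map D.T.symm D.μ := by
  rw [D.rnDeriv]
  refine withDensity_absolutelyContinuous' D.ωCont.measurable.ennreal_ofReal.aemeasurable ?_
  exact Eventually.of_forall fun x => by simpa using D.ωPos x

lemma measure_preimage_symm_eq_zero {N : Set X} (hN : D.μ N = 0) :
    D.μ (D.T.symm ⁻¹' N) = 0 := by
  have h := D.map_symm_absolutelyContinuous hN
  rwa [← Homeomorph.toMeasurableEquiv_coe, MeasurableEquiv.map_apply] at h

lemma measure_preimage_eq_zero {N : Set X} (hN : D.μ N = 0) : D.μ (D.T ⁻¹' N) = 0 := by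
  apply D.absolutelyContinuous_map_symm
  rw [← Homeomorph.toMeasurableEquiv_coe, MeasurableEquiv.map_apply]
  convert hN
  ext x
  simp

lemma measure_preimage_iter_eq_zero {N : Set X} (hN : D.μ N = 0) (n : ℤ) :
    D.μ (D.iter n ⁻¹' N) = 0 := by
  induction n using Int.induction_on with
  | zero => simpa [preimage]
  | succ n ih =>
    convert D.measure_preimage_eq_zero ih using 2
    ext x
    simp [← iter_one, iter_iter]
  | pred n ih =>
    convert D.measure_preimage_symm_eq_zero ih using 2
    ext x
    obtain ⟨y, rfl⟩ := D.T.surjective x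
    simp only [mem_preimage, Homeomorph.symm_apply_apply]
    rw [← iter_one, iter_iter, sub_add_cancel]

lemma inessRed_iInter_preimage_iter {S : Set X} (hS : IsGδ S) (hμ : D.μ Sᶜ = 0) :
    D.InessRed (⋂ n, D.iter n ⁻¹' S) := by
  have := D.prob
  have hG : IsGδ (⋂ n, D.iter n ⁻¹' S) :=
    IsGδ.iInter fun n => hS.preimage (D.continuous_iter n)
  have h0 : D.μ (⋂ n, D.iter n ⁻¹' S)ᶜ = 0 := by
    rw [compl_iInter, measure_iUnion_null_iff]
    exact fun n => D.measure_preimage_iter_eq_zero hμ n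
  refine ⟨?_, D.dense_of_measure_compl_eq_zero h0, hG,
    (prob_compl_eq_zero_iff hG.measurableSet).1 h0⟩
  ext x
  simp only [mem_preimage, mem_iInter, ← iter_one, iter_iter]
  exact ⟨fun h n => by simpa using h (n - 1), fun h n => h (n + 1)⟩

lemma InessRed.measure_compl {S : Set X} (hS : D.InessRed S) : D.μ Sᶜ = 0 := by
  have := D.prob
  exact (prob_compl_eq_zero_iff hS.2.2.1.measurableSet).2 hS.2.2.2

/-- Almost every point has a dense orbit. -/
lemma dense_orbits [SecondCountableTopology X] :
    IsGδ {x | DenseRange fun n => D.iter n x} ∧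
      D.μ {x | DenseRange fun n => D.iter n x}ᶜ = 0 := by
  have := D.prob
  let b := TopologicalSpace.countableBasis X
  have hb := TopologicalSpace.isBasis_countableBasis X
  have : Countable b := (TopologicalSpace.countable_countableBasis X).to_subtype
  have heq : {x | DenseRange fun n => D.iter n x} =
      ⋂ U : b, ⋃ n, D.iter n ⁻¹' (U : Set X) := by
    ext x
    simp only [mem_ofPred_eq, DenseRange, hb.dense_iff, mem_iInter, mem_iUnion]
    constructor
    · rintro h ⟨U, hU⟩
      obtain ⟨_, hy, n, rfl⟩ := h U hU (TopologicalSpace.nonempty_of_mem_countableBasis hU)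
      exact ⟨n, hy⟩
    · intro h U hU _
      obtain ⟨n, hn⟩ := h ⟨U, hU⟩
      exact ⟨_, hn, n, rfl⟩
  have hopen : ∀ U : b, IsOpen (⋃ n, D.iter n ⁻¹' (U : Set X)) := fun U =>
    isOpen_iUnion fun n => (hb.isOpen U.2).preimage (D.continuous_iter n)
  rw [heq]
  refine ⟨IsGδ.iInter_of_isOpen hopen, ?_⟩
  rw [compl_iInter, measure_iUnion_null_iff]
  intro U
  rw [prob_compl_eq_zero_iff (hopen U).measurableSet]
  refine (D.ergodic _ (hopen U).measurableSet ?_).resolve_left (D.fullSupport _ (hopen U) ?_).ne'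
  · ext x
    simp only [mem_preimage, mem_iUnion, ← iter_one, iter_iter]
    exact ⟨fun ⟨n, h⟩ => ⟨n + 1, h⟩, fun ⟨n, h⟩ => ⟨n - 1, by simpa using h⟩⟩
  · obtain ⟨x, hx⟩ := TopologicalSpace.nonempty_of_mem_countableBasis U.2
    exact ⟨x, mem_iUnion.2 ⟨0, by simpa using hx⟩⟩

/-- Every non-empty open set contains a virtually clopen set of positive measure. -/
lemma exists_virtClopen_subset [TopologicalSpace.MetrizableSpace X]
    {G : Set X} (hG : IsOpen G) (hne : G.Nonempty) :
    ∃ A ⊆ G, D.VirtClopen A ∧ 0 < D.μ A := by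
  have := D.prob
  let := TopologicalSpace.metrizableSpaceMetric X
  obtain ⟨x, hx⟩ := hne
  obtain ⟨r, hr, hrG⟩ := Metric.isOpen_iff.1 hG x hx
  obtain ⟨s, ⟨hs0, hsr⟩, hs⟩ := exists_null_frontier_thickening D.μ {x} hr
  rw [Metric.thickening_singleton] at hs
  refine ⟨Metric.ball x s, (Metric.ball_subset_ball hsr.le).trans hrG, ?_,
    D.fullSupport _ Metric.isOpen_ball ⟨x, Metric.mem_ball_self hs0⟩⟩
  refine ⟨_, D.inessRed_iInter_preimage_iter
    (isClosed_frontier (s := Metric.ball x s)).isOpen_compl.isGδ (by simpa using hs), ?_⟩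
  refine isClopen_preimage_val Metric.isOpen_ball (disjoint_right.2 fun y hy => ?_)
  simpa using mem_iInter.1 hy 0

end Reductions

section Cocycle

variable {X : Type*} [TopologicalSpace X] [MeasurableSpace X] [BorelSpace X] (D : DynSys X) {θ : ℝ}

lemma exists_rho_close [TopologicalSpace.MetrizableSpace X] {t : ℝ} (ht : t ∈ D.topAsymRange)
    {G : Set X} (hG : IsOpen G) (hne : G.Nonempty) {δ : ℝ} (hδ : 0 < δ) :
    ∃ z ∈ G, ∃ n, |D.rho z n - t| < δ := by
  obtain ⟨A, hAG, hA, hpos⟩ := D.exists_virtClopen_subset hG hne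
  obtain ⟨k, -, B, hBA, hB, h⟩ := ht δ hδ A hA hpos
  obtain ⟨z, hz⟩ := nonempty_of_measure_ne_zero hB.ne'
  exact ⟨z, hAG (hBA hz), k, h z hz⟩

lemma exists_isOpen_rho_far {t : ℝ} (ht : t ∉ D.topAsymRange) (ht0 : t ≠ 0) :
    ∃ ε > 0, ∃ O : Set X, IsOpen O ∧ O.Nonempty ∧ ∀ x ∈ O, ∀ k, ε ≤ |D.rho x k - t| := by
  simp only [topAsymRange, mem_ofPred_eq, not_forall, not_exists, not_and] at ht
  obtain ⟨ε, hε, A, ⟨X', hX', hA⟩, hpos, h⟩ := ht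
  obtain ⟨O, hO, hOA⟩ := isOpen_induced_iff.1 hA.isOpen
  have hmem : ∀ x ∈ X', x ∈ O ↔ x ∈ A := fun x hx => by
    simpa using Set.ext_iff.1 hOA ⟨x, hx⟩
  refine ⟨min ε |t|, lt_min hε (abs_pos.2 ht0), O, hO, ?_, fun x hx k => ?_⟩
  · by_contra hne
    have : A ⊆ X'ᶜ := fun x hxA hx => hne ⟨x, (hmem x hx).2 hxA⟩
    exact hpos.ne' (measure_mono_null this (InessRed.measure_compl D hX'))
  · by_cases hk : k = 0
    · simp [hk]
    refine (min_le_left _ _).trans ?_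
    by_contra hlt
    have hG : IsOpen (O ∩ {y | |D.rho y k - t| < ε}) :=
      hO.inter (isOpen_lt ((D.continuous_rho k).sub continuous_const).abs continuous_const)
    have hGpos := D.fullSupport _ hG ⟨x, hx, not_le.1 hlt⟩
    rw [← measure_inter_add_sdiff₀ _ hX'.2.2.1.measurableSet.nullMeasurableSet,
      measure_mono_null (t := X'ᶜ) (s := _ \ X') (fun y hy => hy.2)
        (InessRed.measure_compl D hX'), add_zero] at hGpos
    obtain ⟨y, hy, hy'⟩ : ∃ y, y ∈ O ∩ {y | |D.rho y k - t| < ε} ∩ X' ∧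
        ¬ |D.rho y k - t| < ε := by
      simpa using h k hk _ (fun y hy => (hmem y hy.2).1 hy.1.1) hGpos
    exact hy' hy.1.2

lemma exists_notMem_graphClosure [TopologicalSpace.MetrizableSpace X]
    (htop : D.topAsymRange = (AddSubgroup.zmultiples θ : Set ℝ)) {t : AddCircle θ} (ht : t ≠ 0) :
    ∃ O : Set X, IsOpen O ∧ O.Nonempty ∧ ∀ x ∈ O, (x, t) ∉ D.graphClosure θ := by
  induction t using QuotientAddGroup.induction_on with | H τ => ?_
  have hτ : τ ∉ D.topAsymRange := by
    rw [htop]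
    exact fun h => ht ((QuotientAddGroup.eq_zero_iff τ).2 h)
  obtain ⟨ε, hε, O, hO, hne, hfar⟩ := D.exists_isOpen_rho_far hτ (by rintro rfl; exact ht rfl)
  refine ⟨O, hO, hne, fun x hx hmem => ?_⟩
  have hV : IsOpen (O ×ˢ ((fun r : ℝ => (r : AddCircle θ)) '' Metric.ball τ ε)) :=
    hO.prod (QuotientAddGroup.isOpenMap_coe _ Metric.isOpen_ball)
  obtain ⟨⟨y, s⟩, ⟨hyO, v, hv, hvk⟩, k, hk⟩ := mem_closure_iff.1 hmem _ hV
    ⟨hx, τ, Metric.mem_ball_self hε, rfl⟩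
  simp only at hyO hvk hk
  rw [hk] at hvk
  rw [Metric.mem_ball, Real.dist_eq] at hv
  have hj : v - D.rho y k ∈ D.topAsymRange := by
    rw [htop]
    refine (QuotientAddGroup.eq_zero_iff _).1 ?_
    exact (AddCircle.coe_sub θ v _).trans (sub_eq_zero.2 hvk)
  have hG : IsOpen (D.iter (-k) ⁻¹' (O ∩
      {z | |D.rho z k - D.rho y k| < (ε - |v - τ|) / 2})) :=
    (hO.inter (isOpen_lt ((D.continuous_rho k).sub continuous_const).abs
      continuous_const)).preimage (D.continuous_iter _)
  have hpos : 0 < (ε - |v - τ|) / 2 := by linarith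
  obtain ⟨z, ⟨hzO, hz⟩, n, hn⟩ := D.exists_rho_close hj hG
    ⟨D.iter k y, by simp [iter_iter, hyO]; linarith⟩ hpos
  have h1 := hfar _ hzO (k + n)
  have h2 := D.rho_add (D.iter (-k) z) k n
  rw [iter_iter, add_neg_cancel, iter_zero] at h2
  simp only [mem_ofPred_eq] at hz
  rw [h2] at h1
  rw [abs_lt] at hz hn
  have h3 := neg_abs_le (v - τ)
  have h4 := le_abs_self (v - τ)
  rcases le_abs.1 h1 with h1 | h1 <;> linarith

lemma translate_unique [Fact (0 < θ)] [SecondCountableTopology X]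
    [TopologicalSpace.MetrizableSpace X]
    (htop : D.topAsymRange = (AddSubgroup.zmultiples θ : Set ℝ)) {x y : X}
    (hx : DenseRange fun n => D.iter n x) (hy : DenseRange fun n => D.iter n y)
    {c c' : AddCircle θ} (hc : ∀ s, (x, s) ∈ D.graphClosure θ → (y, s - c) ∈ D.graphClosure θ)
    (hc' : ∀ s, (x, s) ∈ D.graphClosure θ → (y, s - c') ∈ D.graphClosure θ) : c = c' := by
  by_contra hne
  obtain ⟨O, hO, hOne, hfar⟩ := D.exists_notMem_graphClosure htop (sub_ne_zero.2 hne)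
  obtain ⟨z, hzO, hz⟩ :=
    (D.dense_of_measure_compl_eq_zero D.dense_orbits.2).inter_open_nonempty O hO hOne
  obtain ⟨e, he⟩ := D.exists_translate_section (θ := θ) hx z
  have h1 := D.add_mem_graphClosure hz he (D.zero_mem_graphClosure z)
  refine hfar z hzO ?_
  convert he _ (D.add_mem_graphClosure hy hc (hc' _ h1)) using 2
  abel

/-- The cocycle `ρ_μ` modulo `θ` is a coboundary whose transfer function is continuous at all
points with dense orbit. -/
lemma exists_transfer [Fact (0 < θ)] [SecondCountableTopology X]
    [TopologicalSpace.MetrizableSpace X]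
    (htop : D.topAsymRange = (AddSubgroup.zmultiples θ : Set ℝ)) :
    ∃ φ : X → AddCircle θ, ∀ y, (DenseRange fun n => D.iter n y) → ContinuousAt φ y ∧
      ∀ n, (DenseRange fun m => D.iter m (D.iter n y)) →
        φ (D.iter n y) = φ y + (D.rho y n : AddCircle θ) := by
  by_cases hex : ∃ x, DenseRange fun n => D.iter n x
  swap
  · exact ⟨0, fun y hy => (hex ⟨y, hy⟩).elim⟩
  obtain ⟨x, hx⟩ := hex
  choose φ hφ using D.exists_translate_section (θ := θ) hx
  refine ⟨φ, fun y hy => ⟨?_, fun n hn => ?_⟩⟩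
  · rw [ContinuousAt, tendsto_iff_ultrafilter]
    intro u hu
    have hc : Tendsto φ u (𝓝 (u.map φ).lim) := (u.map φ).le_nhds_lim
    have heq : φ y = (u.map φ).lim := by
      refine D.translate_unique htop hx hy (hφ y) fun s hs => ?_
      exact isClosed_closure.mem_of_tendsto
        (Tendsto.prodMk_nhds (f := (u : Filter X)) hu (tendsto_const_nhds.sub hc))
        (Eventually.of_forall fun z => hφ z s hs)
    rwa [heq]
  · refine D.translate_unique htop hx hn (hφ _) fun s hs => ?_
    simpa [sub_sub] using D.iter_mem_graphClosure (hφ y s hs) n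

/-- Some level set of a circle-valued function that is continuous on a measurable set is null. -/
lemma exists_measure_level_eq_zero [Fact (0 < θ)] {φ : X → AddCircle θ} {S : Set X}
    (hS : MeasurableSet S) (hφ : ContinuousOn φ S) : ∃ a : ℝ, D.μ (φ ⁻¹' {↑a} ∩ S) = 0 := by
  have := D.prob
  by_contra! h
  have hmeas : ∀ p : AddCircle θ, MeasurableSet (φ ⁻¹' {p} ∩ S) := by
    intro p
    obtain ⟨F, hF, hFS⟩ := continuousOn_iff_isClosed.1 hφ {p} isClosed_singleton
    rw [hFS]
    exact hF.measurableSet.inter hS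
  have hcount := Measure.countable_meas_pos_of_disjoint_iUnion (μ := D.μ) hmeas
    fun p q hpq => disjoint_left.2 fun x hx hx' => hpq (hx.1.symm.trans hx'.1)
  have huniv : {p : AddCircle θ | 0 < D.μ (φ ⁻¹' {p} ∩ S)} = univ := by
    refine eq_univ_of_forall fun p => ?_
    induction p using QuotientAddGroup.induction_on with | H a => ?_
    exact pos_iff_ne_zero.2 (h a)
  rw [huniv, countable_univ_iff] at hcount
  have h2 : Countable (Ico (0 : ℝ) (0 + θ)) := (AddCircle.equivIco θ 0).symm.injective.countable
  have h3 := Cardinal.Real.Ico_countable_iff.1 (countable_coe_iff.1 h2)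
  have : 0 < θ := Fact.out
  linarith

theorem exists_continuousOn_density [Fact (0 < θ)] [SecondCountableTopology X]
    [TopologicalSpace.MetrizableSpace X]
    (htop : D.topAsymRange = (AddSubgroup.zmultiples θ : Set ℝ)) :
    ∃ (X' : Set X) (f : X → ℝ), D.InessRed X' ∧
      ContinuousOn f X' ∧ (∀ x, 0 < f x) ∧
      IsProbabilityMeasure (D.μ.withDensity fun x => ENNReal.ofReal (f x)) ∧
      ∀ x ∈ X', ∀ n : ℤ,
        D.rho x n + Real.log (f (D.iter n x)) - Real.log (f x)
          ∈ (AddSubgroup.zmultiples θ : Set ℝ) := by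
  have := D.prob
  obtain ⟨φ, hφ⟩ := D.exists_transfer htop
  obtain ⟨hG, hnull⟩ := D.dense_orbits
  set S := {x | DenseRange fun n => D.iter n x}
  have hφS : ContinuousOn φ S := fun y hy => (hφ y hy).1.continuousWithinAt
  obtain ⟨a, ha⟩ := D.exists_measure_level_eq_zero hG.measurableSet hφS
  have hSa : IsGδ (φ ⁻¹' {(a : AddCircle θ)}ᶜ ∩ S) := by
    obtain ⟨O, hO, hOS⟩ := continuousOn_iff'.1 hφS {(a : AddCircle θ)}ᶜ
      isClosed_singleton.isOpen_compl
    rw [hOS]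
    exact hO.isGδ.inter hG
  have hSa0 : D.μ (φ ⁻¹' {(a : AddCircle θ)}ᶜ ∩ S)ᶜ = 0 := by
    refine measure_mono_null (fun x hx => ?_) (measure_union_null ha hnull)
    by_cases hxS : x ∈ S
    · exact Or.inl ⟨by_contra fun h => hx ⟨h, hxS⟩, hxS⟩
    · exact Or.inr hxS
  let g : X → ℝ := fun x => AddCircle.equivIco θ a (φ x)
  have hgmem : ∀ x, a ≤ g x ∧ g x < a + θ := fun x => (AddCircle.equivIco θ a (φ x)).2
  have hgφ : ∀ x, (g x : AddCircle θ) = φ x := fun x => AddCircle.coe_equivIco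
  set I := ∫⁻ x, ENNReal.ofReal (Real.exp (-g x)) ∂D.μ
  have hIpos : I ≠ 0 := by
    have h : ENNReal.ofReal (Real.exp (-(a + θ))) ≤ I := by
      calc _ = ∫⁻ _, ENNReal.ofReal (Real.exp (-(a + θ))) ∂D.μ := by simp
        _ ≤ I := lintegral_mono fun x => ENNReal.ofReal_le_ofReal
          (Real.exp_le_exp.2 (neg_le_neg (hgmem x).2.le))
    exact ((ENNReal.ofReal_pos.2 (Real.exp_pos _)).trans_le h).ne'
  have hItop : I ≠ ⊤ := by
    have h : I ≤ ENNReal.ofReal (Real.exp (-a)) := by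
      calc I ≤ ∫⁻ _, ENNReal.ofReal (Real.exp (-a)) ∂D.μ :=
          lintegral_mono fun x => ENNReal.ofReal_le_ofReal
            (Real.exp_le_exp.2 (neg_le_neg (hgmem x).1))
        _ = _ := by simp
    exact (h.trans_lt ENNReal.ofReal_lt_top).ne
  have hr : 0 < I.toReal⁻¹ := inv_pos.2 (ENNReal.toReal_pos hIpos hItop)
  refine ⟨_, fun x => I.toReal⁻¹ * Real.exp (-g x), D.inessRed_iInter_preimage_iter hSa hSa0,
    ?_, fun x => mul_pos hr (Real.exp_pos _), ⟨?_⟩, fun x hx n => ?_⟩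
  · intro x hx
    have hx0 : φ x ≠ a ∧ x ∈ S := by simpa using mem_iInter.1 hx 0
    have hg : ContinuousAt g x := continuousAt_subtype_val.comp
      ((AddCircle.continuousAt_equivIco θ a hx0.1).comp (hφ x hx0.2).1)
    exact (continuousAt_const.mul (Real.continuous_exp.continuousAt.comp
      hg.neg)).continuousWithinAt
  · rw [withDensity_apply _ MeasurableSet.univ, Measure.restrict_univ]
    simp_rw [ENNReal.ofReal_mul hr.le]
    rw [lintegral_const_mul' _ _ ENNReal.ofReal_ne_top,
      ENNReal.ofReal_inv_of_pos (ENNReal.toReal_pos hIpos hItop), ENNReal.ofReal_toReal hItop]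
    exact ENNReal.inv_mul_cancel hIpos hItop
  · have hx0 : x ∈ S := by simpa using (mem_iInter.1 hx 0).2
    have hcob := (hφ x hx0).2 n (mem_iInter.1 hx n).2
    simp only [Real.log_mul hr.ne' (Real.exp_ne_zero _), Real.log_exp]
    refine (QuotientAddGroup.eq_zero_iff _).1 ?_
    have heq : D.rho x n + (Real.log I.toReal⁻¹ + -g (D.iter n x)) -
        (Real.log I.toReal⁻¹ + -g x) = D.rho x n - g (D.iter n x) + g x := by ring
    rw [heq]
    change ((D.rho x n - g (D.iter n x) + g x : ℝ) : AddCircle θ) = 0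
    rw [AddCircle.coe_add, AddCircle.coe_sub, hgφ, hgφ, hcob]
    abel

end Cocycle

end DynSys

/-- **Proposition 2.1.** If `r_top(ρ_μ) = (log λ)·ℤ` (`0 < λ < 1`) then there is an
equivalent probability measure `μ̃ = f·μ` with `f` positive, continuous on an
inessential reduction, whose Radon–Nikodym cocycle takes values in `(log λ)·ℤ`. -/
theorem exists_special_measure {X : Type*}
    [TopologicalSpace X] [PolishSpace X] [MeasurableSpace X] [BorelSpace X]
    (D : DynSys X) (lam : ℝ) (hl0 : 0 < lam) (hl1 : lam < 1)
    (htop : D.topAsymRange = (AddSubgroup.zmultiples (Real.log lam) : Set ℝ)) :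
    ∃ (X' : Set X) (f : X → ℝ), D.InessRed X' ∧
      ContinuousOn f X' ∧ (∀ x, 0 < f x) ∧
      IsProbabilityMeasure (D.μ.withDensity fun x => ENNReal.ofReal (f x)) ∧
      ∀ x ∈ X', ∀ n : ℤ,
        D.rho x n + Real.log (f (D.iter n x)) - Real.log (f x)
          ∈ (AddSubgroup.zmultiples (Real.log lam) : Set ℝ) := by
  have : Fact (0 < -Real.log lam) := ⟨neg_pos.2 (Real.log_neg hl0 hl1)⟩
  rw [← AddSubgroup.zmultiples_neg] at htop ⊢
  exact D.exists_continuousOn_density htop
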